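/- arXiv:0704.2708 — 10 statements merged into one kernel-verified Lean document; each statement's English description precedes it below -/
import Mathlib

section
/- Let K be a field and n a positive integer. If 𝓘 is an infinite family of monomial ideals in the polynomial ring K[x_1,…,x_n], then there exist two distinct ideals I, J ∈ 𝓘 with I ⊆ J. -/
/-- Antitone sequences in a well-quasi-ordered partial order are well-quasi-ordered pointwise:
a sequence is determined by a finite initial segment, to which Higman's lemma applies. -/
theorem exists_lt_le_of_antitone {Q : Type*} [PartialOrder Q] [WellQuasiOrderedLE Q]
    (U : ℕ → ℕ → Q) (hU : ∀ i, Antitone (U i)) : ∃ i j, i < j ∧ U i ≤ U j := by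
  have hstab : ∀ i, ∃ m, ∀ k, m ≤ k → U i k = U i m := by
    intro i
    obtain ⟨_, ⟨m, rfl⟩, hm⟩ :=
      (wellFounded_lt (α := Q)).has_min (Set.range (U i)) (Set.range_nonempty _)
    exact ⟨m, fun k hk => eq_of_le_of_not_lt (hU i hk) (hm _ ⟨k, rfl⟩)⟩
  choose m hm using hstab
  have hlist : WellQuasiOrdered (List.SublistForall₂ ((· ≤ ·) : Q → Q → Prop)) := by
    have h := Set.PartiallyWellOrderedOn.partiallyWellOrderedOn_sublistForall₂
      ((· ≤ ·) : Q → Q → Prop)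
      (Set.partiallyWellOrderedOn_univ_iff.mpr (wellQuasiOrdered_le (α := Q)))
    simpa [Set.partiallyWellOrderedOn_univ_iff] using h
  have : IsPreorder (List Q) (List.SublistForall₂ ((· ≤ ·) : Q → Q → Prop)) := { }
  have hprod := hlist.prod (wellQuasiOrdered_le (α := Q))
  obtain ⟨i, j, hij, hsub, hlim⟩ :=
    hprod fun i => ((List.range (m i)).map (U i), U i (m i))
  refine ⟨i, j, hij, fun k => ?_⟩
  rcases lt_or_ge k (m i) with hk | hk
  · obtain ⟨l, hl, hlsub⟩ := List.sublistForall₂_iff.mp hsub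
    obtain ⟨f, hf⟩ := List.sublist_iff_exists_orderEmbedding_getElem?_eq.mp hlsub
    obtain ⟨hlen, hget⟩ := List.forall₂_iff_get.mp hl
    have hkl : k < l.length := by simpa [← hlen] using hk
    have hle := hget k (by simpa using hk) hkl
    have hfk := hf k
    rw [List.getElem?_eq_getElem hkl, eq_comm, List.getElem?_eq_some_iff] at hfk
    obtain ⟨h₁, h₂⟩ := hfk
    simp only [List.get_eq_getElem, ← h₂, List.getElem_map, List.getElem_range] at hle
    exact hle.trans (hU j f.strictMono.le_apply)
  · rw [hm i k hk]
    refine le_trans hlim ?_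
    rcases le_total k (m j) with h | h
    · exact hU j h
    · exact (hm j k h).ge

/-- The slice of an upper set of `ℕ × P` at a given first coordinate. -/
def UpperSet.slice {P : Type*} [Preorder P] (U : UpperSet (ℕ × P)) (k : ℕ) : UpperSet P :=
  ⟨{p | (k, p) ∈ U}, fun _ _ hpq hp => U.upper (Prod.mk_le_mk.mpr ⟨le_rfl, hpq⟩) hp⟩

theorem UpperSet.wellQuasiOrderedLE_nat_prod {P : Type*} [Preorder P]
    [WellQuasiOrderedLE (UpperSet P)] : WellQuasiOrderedLE (UpperSet (ℕ × P)) := by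
  refine ⟨fun U => ?_⟩
  obtain ⟨i, j, hij, h⟩ := exists_lt_le_of_antitone (fun i => (U i).slice)
    fun i k l hkl p hp => (U i).upper (Prod.mk_le_mk.mpr ⟨hkl, le_rfl⟩) hp
  exact ⟨i, j, hij, fun x hx => h x.1 hx⟩

theorem UpperSet.wellQuasiOrderedLE_fin_nat (n : ℕ) :
    WellQuasiOrderedLE (UpperSet (Fin n → ℕ)) := by
  induction n with
  | zero =>
    have : Finite (UpperSet (Fin 0 → ℕ)) := Finite.of_injective _ SetLike.coe_injective
    exact Finite.to_wellQuasiOrderedLE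
  | succ n ih =>
    exact (UpperSet.map (Fin.consOrderIso fun _ : Fin (n + 1) => ℕ)).wellQuasiOrderedLE_iff.mp
      UpperSet.wellQuasiOrderedLE_nat_prod

/-- The upper set of exponents of the monomials lying in an ideal. -/
def Ideal.monomialExponents {R : Type*} [CommSemiring R] {n : ℕ}
    (I : Ideal (MvPolynomial (Fin n) R)) : UpperSet (Fin n → ℕ) where
  carrier := {a | MvPolynomial.monomial (Finsupp.equivFunOnFinite.symm a) (1 : R) ∈ I}
  upper' a b hab ha := by
    have h : Finsupp.equivFunOnFinite.symm b =
        Finsupp.equivFunOnFinite.symm (b - a) + Finsupp.equivFunOnFinite.symm a := by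
      ext i
      simpa using (Nat.sub_add_cancel (hab i)).symm
    have := I.mul_mem_left
      (MvPolynomial.monomial (Finsupp.equivFunOnFinite.symm (b - a)) (1 : R)) ha
    rwa [MvPolynomial.monomial_mul, one_mul, ← h] at this

/-- If `𝓘` is an infinite family of monomial ideals in `K[x_1,…,x_n]`, then there are two
distinct ideals `I, J ∈ 𝓘` with `I ⊆ J`. -/
theorem stmt0 (K : Type*) [Field K] (n : ℕ) (hn : 0 < n)
    (𝓘 : Set (Ideal (MvPolynomial (Fin n) K)))
    (hmono : ∀ I ∈ 𝓘, ∃ S : Set (Fin n →₀ ℕ),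
      I = Ideal.span ((fun a => (MvPolynomial.monomial a (1 : K))) '' S))
    (hinf : 𝓘.Infinite) :
    ∃ I ∈ 𝓘, ∃ J ∈ 𝓘, I ≠ J ∧ I ≤ J := by
  have := UpperSet.wellQuasiOrderedLE_fin_nat n
  let g := hinf.natEmbedding
  obtain ⟨i, j, hij, h⟩ := wellQuasiOrdered_le fun i => (g i).1.monomialExponents
  refine ⟨g j, (g j).2, g i, (g i).2,
    fun e => hij.ne' (g.injective (Subtype.ext e)), ?_⟩
  obtain ⟨S, hS⟩ := hmono (g j) (g j).2
  rw [hS, Ideal.span_le]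
  rintro _ ⟨a, ha, rfl⟩
  have hmem : (a : Fin n → ℕ) ∈ (g j).1.monomialExponents := by
    change MvPolynomial.monomial (Finsupp.equivFunOnFinite.symm (a : Fin n → ℕ)) (1 : K) ∈ (g j).1
    rw [Finsupp.equivFunOnFinite_symm_coe, hS]
    exact Ideal.subset_span ⟨a, ha, rfl⟩
  have hmem' : MvPolynomial.monomial (Finsupp.equivFunOnFinite.symm (a : Fin n → ℕ)) (1 : K) ∈
      (g i).1 := h hmem
  rwa [Finsupp.equivFunOnFinite_symm_coe] at hmem'
end

section
/- Fix 0 ≤ k ≤ n. The set of all b ∈ M such that Q_b^{(k)} ≠ ∅ and Q_b^{(k)} is atomic w.r.t. ⊕ and M is finite; equivalently, there are only finitely many nonempty partially extended fibers of order k that are atomic w.r.t. the finitely generated monoid M. -/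
open Matrix Pointwise

/-- Partially extended fiber of order `k`: `Q_b^{(k)} = {z ∈ ℤ^n : Az = b, z_i ≥ 0 for i < k}`. -/
def Qfib {d n : ℕ} (A : Matrix (Fin d) (Fin n) ℤ) (k : ℕ) (b : Fin d → ℤ) :
    Set (Fin n → ℤ) :=
  {z | A.mulVec z = b ∧ ∀ i : Fin n, (i : ℕ) < k → 0 ≤ z i}

/-- `u ⊑_l v`: componentwise sign-compatible and dominated on the first `l` components. -/
def sqle (n l : ℕ) (u v : Fin n → ℤ) : Prop :=
  ∀ i : Fin n, (i : ℕ) < l → 0 ≤ u i * v i ∧ |u i| ≤ |v i|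

/-- `U = V ⊕^{(l)} W`: every `u ∈ U` splits as `u = v + w` with `v ∈ V`, `w ∈ W`,
`v ⊑_l u` and `w ⊑_l u`. -/
def oplus {n : ℕ} (l : ℕ) (U V W : Set (Fin n → ℤ)) : Prop :=
  ∀ u ∈ U, ∃ v ∈ V, ∃ w ∈ W, sqle n l v u ∧ sqle n l w u ∧ u = v + w

/-- Projection onto the first `l` components (encoded by zeroing the others). -/
def projVec (n l : ℕ) (z : Fin n → ℤ) : Fin n → ℤ :=
  fun i => if (i : ℕ) < l then z i else 0

/-- `π_l(U)`. -/
def projSet {n : ℕ} (l : ℕ) (U : Set (Fin n → ℤ)) : Set (Fin n → ℤ) :=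
  projVec n l '' U

/-- The submonoid of `ℤ^d` generated by `m_1, …, m_t`. -/
def monoidGen {d t : ℕ} (m : Fin t → Fin d → ℤ) : Set (Fin d → ℤ) :=
  {b | ∃ α : Fin t → ℕ, b = ∑ i, (α i : ℤ) • m i}

/-- `Q_b^{(k)}` is atomic w.r.t. `⊕^{(l)}` and `M`. -/
def AtomicFiber {d n : ℕ} (A : Matrix (Fin d) (Fin n) ℤ) (k l : ℕ)
    (M : Set (Fin d → ℤ)) (b : Fin d → ℤ) : Prop :=
  ¬ ∃ b₁ ∈ M, ∃ b₂ ∈ M,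
      oplus l (Qfib A k b) (Qfib A k b₁) (Qfib A k b₂) ∧
      projSet l (Qfib A k b₁) ≠ projSet l (Qfib A k (0 : Fin d → ℤ)) ∧
      projSet l (Qfib A k b₂) ≠ projSet l (Qfib A k (0 : Fin d → ℤ))

/-- `Q_b^{(k)}` is atomic w.r.t. `⊕ = ⊕^{(n)}` and `M` (fiber-inequality form, since
`π_n` is the identity). -/
def AtomicFiberQ {d n : ℕ} (A : Matrix (Fin d) (Fin n) ℤ) (k : ℕ)
    (M : Set (Fin d → ℤ)) (b : Fin d → ℤ) : Prop :=
  ¬ ∃ b₁ ∈ M, ∃ b₂ ∈ M,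
      oplus n (Qfib A k b) (Qfib A k b₁) (Qfib A k b₂) ∧
      Qfib A k b₁ ≠ Qfib A k (0 : Fin d → ℤ) ∧
      Qfib A k b₂ ≠ Qfib A k (0 : Fin d → ℤ)

/-- `S̄^{(l)}`: integer combinations of the last `n - l` columns of `A` that lie in `M`. -/
def SbarSet {d n : ℕ} (A : Matrix (Fin d) (Fin n) ℤ) (l : ℕ)
    (M : Set (Fin d → ℤ)) : Set (Fin d → ℤ) :=
  {s | s ∈ M ∧ ∃ lam : Fin n → ℤ, (∀ i : Fin n, (i : ℕ) < l → lam i = 0) ∧ s = A.mulVec lam}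

/-- `U = ⊕^{(l)}_{j} V_j` for a finite family. -/
def oplusFam {n : ℕ} (l : ℕ) {r : ℕ} (U : Set (Fin n → ℤ))
    (V : Fin r → Set (Fin n → ℤ)) : Prop :=
  ∀ u ∈ U, ∃ v : Fin r → Fin n → ℤ,
    (∀ j, v j ∈ V j) ∧ (∀ j, sqle n l (v j) u) ∧ u = ∑ j, v j

/-- `b(α) = Σ α_i m_i`. -/
def bOf {d t : ℕ} (m : Fin t → Fin d → ℤ) (α : Fin t → ℕ) : Fin d → ℤ :=
  ∑ i, (α i : ℤ) • m i

/-- `(β, Q_{b(β)}^{(k)})` reduces `(α, Q_{b(α)}^{(k)})`. -/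
def Reduces {d n t : ℕ} (A : Matrix (Fin d) (Fin n) ℤ) (m : Fin t → Fin d → ℤ)
    (k : ℕ) (β α : Fin t → ℕ) : Prop :=
  β ≤ α ∧
    oplus n (Qfib A k (bOf m α)) (Qfib A k (bOf m β)) (Qfib A k (bOf m α - bOf m β))

/-- The complement of a finitely generated upper set of `ι → ℕ` is a finite union of boxes. -/
theorem exists_boxes_of_finset {ι : Type*} [Fintype ι] (F : Finset (ι → ℕ)) :
    ∃ L : List (ι → ℕ∞), ∀ x : ι → ℕ,
      (∀ g ∈ F, ¬ g ≤ x) ↔ ∃ y ∈ L, ∀ i, (x i : ℕ∞) < y i := by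
  classical
  induction F using Finset.induction_on with
  | empty => exact ⟨[⊤], fun x => by simp⟩
  | insert g F _ ih =>
    obtain ⟨L, hL⟩ := ih
    refine ⟨L.flatMap fun y => (Finset.univ : Finset ι).toList.map fun i =>
      y ⊓ Function.update ⊤ i (g i : ℕ∞), fun x => ?_⟩
    have hbox : ∀ i, (∀ j, (x j : ℕ∞) < (Function.update ⊤ i (g i : ℕ∞) : ι → ℕ∞) j) ↔
        x i < g i := by
      intro i
      refine ⟨fun h => by simpa using h i, fun h j => ?_⟩
      by_cases hj : j = i
      · subst hj
        simpa using h
      · simp [hj]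
    have hg : ¬ g ≤ x ↔ ∃ i, x i < g i := by simp [Pi.le_def]
    rw [Finset.forall_mem_insert, hL, hg]
    constructor
    · rintro ⟨⟨i, hi⟩, y, hy, hxy⟩
      refine ⟨y ⊓ Function.update ⊤ i (g i : ℕ∞), ?_, fun j => ?_⟩
      · rw [List.mem_flatMap]
        exact ⟨y, hy, List.mem_map.2 ⟨i, by simp, rfl⟩⟩
      · exact lt_inf_iff.2 ⟨hxy j, (hbox i).2 hi j⟩
    · rintro ⟨z, hz, hxz⟩
      obtain ⟨y, hy, hz⟩ := List.mem_flatMap.1 hz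
      obtain ⟨i, -, rfl⟩ := List.mem_map.1 hz
      exact ⟨⟨i, (hbox i).1 fun j => (lt_inf_iff.1 (hxz j)).2⟩, y, hy,
        fun j => (lt_inf_iff.1 (hxz j)).1⟩

/-- The complement of an upper set of `ι → ℕ` is a finite union of boxes. -/
theorem exists_boxes {ι : Type*} [Fintype ι] (V : Set (ι → ℕ)) :
    ∃ L : List (ι → ℕ∞), ∀ x : ι → ℕ,
      (∀ g ∈ V, ¬ g ≤ x) ↔ ∃ y ∈ L, ∀ i, (x i : ℕ∞) < y i := by
  have hfin : {g | Minimal (· ∈ V) g}.Finite :=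
    WellQuasiOrderedLE.finite_of_isAntichain (setOfPred_minimal_antichain _)
  obtain ⟨L, hL⟩ := exists_boxes_of_finset hfin.toFinset
  refine ⟨L, fun x => ?_⟩
  rw [← hL]
  refine ⟨fun h g hg => h g ((hfin.mem_toFinset.1 hg).prop), fun h g hg hgx => ?_⟩
  obtain ⟨g', hg'g, hg'⟩ := exists_minimal_le_of_wellFoundedLT (· ∈ V) g hg
  exact h g' (hfin.mem_toFinset.2 hg') (hg'g.trans hgx)

theorem List.SublistForall₂.exists_rel {α β : Type*} {R : α → β → Prop} {l₁ : List α}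
    {l₂ : List β} (h : List.SublistForall₂ R l₁ l₂) : ∀ a ∈ l₁, ∃ b ∈ l₂, R a b := by
  induction h with
  | nil => simp
  | cons hab _ ih =>
    intro a ha
    rcases List.mem_cons.1 ha with rfl | ha
    · exact ⟨_, by simp, hab⟩
    · obtain ⟨b, hb, h⟩ := ih a ha
      exact ⟨b, List.mem_cons_of_mem _ hb, h⟩
  | cons_right _ ih =>
    intro a ha
    obtain ⟨b, hb, h⟩ := ih a ha
    exact ⟨b, List.mem_cons_of_mem _ hb, h⟩

/-- Upper sets of `ι → ℕ`, given by generators, are well-quasi-ordered by reverse inclusion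
(Maclagan's theorem on monomial ideals). -/
theorem wellQuasiOrdered_upperSet_generators (ι : Type*) [Fintype ι] :
    WellQuasiOrdered fun V W : Set (ι → ℕ) => ∀ w ∈ W, ∃ v ∈ V, v ≤ w := by
  intro f
  choose L hL using fun j => exists_boxes (f j)
  have hwqo : (Set.univ : Set (ι → ℕ∞)).PartiallyWellOrderedOn (· ≤ ·) :=
    Set.partiallyWellOrderedOn_univ_iff.2 wellQuasiOrdered_le
  obtain ⟨i, j, hij, hle⟩ :=
    (Set.PartiallyWellOrderedOn.partiallyWellOrderedOn_sublistForall₂ _ hwqo).exists_lt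
      (f := L) (by simp)
  refine ⟨i, j, hij, fun w hw => ?_⟩
  by_contra! hno
  obtain ⟨y, hy, hwy⟩ := (hL i w).1 hno
  obtain ⟨y', hy', hyy'⟩ := hle.exists_rel y hy
  exact (hL j w).2 ⟨y', hy', fun s => (hwy s).trans_le (hyy' s)⟩ w hw le_rfl

/-- The positive and negative parts of an integer vector. -/
def posNegParts {n : ℕ} (z : Fin n → ℤ) : Fin n ⊕ Fin n → ℕ :=
  Sum.elim (fun i => (z i).toNat) fun i => (-z i).toNat

theorem between_of_posNegParts_le {n : ℕ} {u v : Fin n → ℤ}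
    (h : posNegParts v ≤ posNegParts u) (i : Fin n) :
    (0 ≤ v i ∧ v i ≤ u i) ∨ (u i ≤ v i ∧ v i ≤ 0) := by
  have h₁ : (v i).toNat ≤ (u i).toNat := h (Sum.inl i)
  have h₂ : (-v i).toNat ≤ (-u i).toNat := h (Sum.inr i)
  omega

theorem sqle_of_between {n l : ℕ} {u v : Fin n → ℤ}
    (h : ∀ i, (0 ≤ v i ∧ v i ≤ u i) ∨ (u i ≤ v i ∧ v i ≤ 0)) : sqle n l v u := by
  intro i _
  rcases h i with ⟨h₁, h₂⟩ | ⟨h₁, h₂⟩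
  · exact ⟨mul_nonneg h₁ (h₁.trans h₂), abs_le_abs_of_nonneg h₁ h₂⟩
  · exact ⟨mul_nonneg_of_nonpos_of_nonpos h₂ (h₁.trans h₂), abs_le_abs_of_nonpos h₂ h₁⟩

theorem oplus_of_posNegParts {d n : ℕ} (A : Matrix (Fin d) (Fin n) ℤ) (k l : ℕ)
    (b b' : Fin d → ℤ)
    (h : ∀ w ∈ posNegParts '' Qfib A k b', ∃ v ∈ posNegParts '' Qfib A k b, v ≤ w) :
    oplus l (Qfib A k b') (Qfib A k b) (Qfib A k (b' - b)) := by
  intro u hu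
  obtain ⟨_, ⟨v, hv, rfl⟩, hvu⟩ := h _ (Set.mem_image_of_mem _ hu)
  have hb := between_of_posNegParts_le hvu
  refine ⟨v, hv, u - v, ⟨?_, fun i hi => ?_⟩, sqle_of_between hb,
    sqle_of_between fun i => ?_, by simp⟩
  · rw [Matrix.mulVec_sub, hu.1, hv.1]
  · have h₁ := hu.2 i hi
    have h₂ := hb i
    have h₃ := hv.2 i hi
    simp only [Pi.sub_apply]
    omega
  · have h₂ := hb i
    simp only [Pi.sub_apply]
    omega

theorem projSet_Qfib_ne_zero {d n : ℕ} (A : Matrix (Fin d) (Fin n) ℤ) (k : ℕ)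
    {b : Fin d → ℤ} (hb : b ≠ 0) (hne : (Qfib A k b).Nonempty) :
    projSet n (Qfib A k b) ≠ projSet n (Qfib A k (0 : Fin d → ℤ)) := by
  have hid : projVec n n = id := by
    funext z i
    simp [projVec]
  intro h
  simp only [projSet, hid, Set.image_id] at h
  obtain ⟨z, hz⟩ := hne
  have hz₀ : z ∈ Qfib A k 0 := h ▸ hz
  exact hb (hz.1.symm.trans hz₀.1)

/-- There are only finitely many nonempty partially extended fibers of order `k` that are
atomic w.r.t. `⊕` and the finitely generated monoid `M`. -/
theorem stmt1 (d n t : ℕ) (hn : 0 < n) (A : Matrix (Fin d) (Fin n) ℤ)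
    (m : Fin t → Fin d → ℤ) (k : ℕ) (hk : k ≤ n) :
    Set.Finite {b : Fin d → ℤ | b ∈ monoidGen m ∧ (Qfib A k b).Nonempty ∧
      AtomicFiber A k n (monoidGen m) b} := by
  by_contra hinf
  set S := {b : Fin d → ℤ | b ∈ monoidGen m ∧ (Qfib A k b).Nonempty ∧
      AtomicFiber A k n (monoidGen m) b}
  have hS₀ : (S \ {0}).Infinite := Set.Infinite.sdiff hinf (Set.finite_singleton 0)
  let f : ℕ ↪ ↥(S \ {0}) := hS₀.natEmbedding
  choose α hα using fun j => (f j).2.1.1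
  obtain ⟨i, j, hij, hle, hU⟩ :=
    ((wellQuasiOrdered_le (α := Fin t → ℕ)).prod
      (wellQuasiOrdered_upperSet_generators (Fin n ⊕ Fin n)))
      fun j => (α j, posNegParts '' Qfib A k (f j : Fin d → ℤ))
  have hoplus := oplus_of_posNegParts A k n _ _ hU
  obtain ⟨u, hu⟩ := (f j).2.1.2.1
  obtain ⟨-, -, w, hw, -⟩ := hoplus u hu
  refine (f j).2.1.2.2 ⟨f i, (f i).2.1.1, f j - f i, ⟨α j - α i, ?_⟩, hoplus,
    projSet_Qfib_ne_zero A k (f i).2.2 (f i).2.1.2.1,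
    projSet_Qfib_ne_zero A k (sub_ne_zero.2 fun h => ?_) ⟨w, hw⟩⟩
  · rw [hα i, hα j, ← Finset.sum_sub_distrib]
    refine Finset.sum_congr rfl fun s _ => ?_
    rw [Pi.sub_apply, Nat.cast_sub (hle s), sub_smul]
  · exact hij.ne' (f.injective (Subtype.ext h))
end

section
/- Fix 0 ≤ k ≤ n and let b ∈ M with Q_b^{(k)} ≠ ∅ be such that Q_b^{(k)} is atomic w.r.t. ⊕ and M. Then there exists α ∈ ℤ_+^t with b = Σ_{i=1}^t α_i m_i such that the pair (α, Q_b^{(k)}) is irreducible w.r.t. ⊴. -/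
open Matrix Pointwise

/-- The right-hand side of a fiber equal to the fiber of `0` vanishes. -/
theorem eq_zero_of_Qfib_eq {d n : ℕ} {A : Matrix (Fin d) (Fin n) ℤ} {k : ℕ} {b : Fin d → ℤ}
    (h : Qfib A k b = Qfib A k 0) : b = 0 := by
  have h0 : (0 : Fin n → ℤ) ∈ Qfib A k b := by
    rw [h]
    exact ⟨Matrix.mulVec_zero A, fun _ _ => le_rfl⟩
  rw [← h0.1, Matrix.mulVec_zero]

theorem bOf_sub {d t : ℕ} (m : Fin t → Fin d → ℤ) {α β : Fin t → ℕ} (h : β ≤ α) :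
    bOf m (α - β) = bOf m α - bOf m β := by
  simp only [bOf, ← Finset.sum_sub_distrib, ← sub_smul, Pi.sub_apply]
  exact Finset.sum_congr rfl fun i _ => by rw [Nat.cast_sub (h i)]

/-- If `Q_b^{(k)}` is a nonempty fiber atomic w.r.t. `⊕` and `M`, then there is
`α ∈ ℤ_+^t` with `b = Σ α_i m_i` such that `(α, Q_b^{(k)})` is irreducible w.r.t. `⊴`. -/
theorem stmt4 (d n t : ℕ) (hn : 0 < n) (A : Matrix (Fin d) (Fin n) ℤ)
    (m : Fin t → Fin d → ℤ) (k : ℕ) (hk : k ≤ n)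
    (b : Fin d → ℤ) (hb : b ∈ monoidGen m) (hne : (Qfib A k b).Nonempty)
    (hatom : AtomicFiberQ A k (monoidGen m) b) :
    ∃ α : Fin t → ℕ, b = bOf m α ∧
      ∀ β : Fin t → ℕ, Reduces A m k β α → β = α ∨ β = 0 := by
  obtain ⟨α, hα, hmin⟩ := WellFounded.has_min (wellFounded_lt (α := Fin t → ℕ))
    {α | b = bOf m α} hb
  refine ⟨α, hα, fun β ⟨hle, hsum⟩ => ?_⟩
  rw [← bOf_sub m hle, ← show b = bOf m α from hα] at hsum
  have hdecomp : Qfib A k (bOf m β) = Qfib A k 0 ∨ Qfib A k (bOf m (α - β)) = Qfib A k 0 := by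
    by_contra! hcon
    exact hatom ⟨_, ⟨β, rfl⟩, _, ⟨α - β, rfl⟩, hsum, hcon⟩
  rcases hdecomp with h | h
  · right
    have hb' : b = bOf m (α - β) := by
      rw [bOf_sub m hle, eq_zero_of_Qfib_eq h, sub_zero]
      exact hα
    have heq : α - β = α :=
      eq_of_le_of_not_lt (fun i => Nat.sub_le _ _) (hmin _ hb')
    funext i
    have hi : α i - β i = α i := congrFun heq i
    have hlei : β i ≤ α i := hle i
    change β i = 0
    omega
  · left
    have h0 := eq_zero_of_Qfib_eq h
    rw [bOf_sub m hle, sub_eq_zero] at h0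
    exact eq_of_le_of_not_lt hle (hmin _ (Eq.trans hα h0))
end

section
/- For every b ∈ ℤ^d and all 0 ≤ k, l ≤ n, the set {π_l(v) : v ∈ Q_b^{(k)} and v is minimal w.r.t. ⊑_l} is finite; i.e., the ⊑_l-minimal elements of Q_b^{(k)} fall into finitely many equivalence classes under equality of the first l components. -/
open Matrix Pointwise

/-- The positive and negative parts of the components of an integer vector. -/
def signParts {n : ℕ} (z : Fin n → ℤ) : Fin n → ℕ × ℕ :=
  fun i => ((z i).toNat, (-z i).toNat)

theorem signParts_injective {n : ℕ} : Function.Injective (signParts (n := n)) := by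
  intro u v h
  funext i
  have hi := Prod.ext_iff.1 (congrFun h i)
  simp only [signParts] at hi
  omega

theorem mul_nonneg_and_abs_le_of_toNat_le {a b : ℤ} (hpos : a.toNat ≤ b.toNat)
    (hneg : (-a).toNat ≤ (-b).toNat) : 0 ≤ a * b ∧ |a| ≤ |b| := by
  rcases le_total 0 a with ha | ha <;> rcases le_total 0 b with hb | hb
  · exact ⟨mul_nonneg ha hb, by rw [abs_of_nonneg ha, abs_of_nonneg hb]; omega⟩
  · obtain rfl : a = 0 := by omega
    simp
  · obtain rfl : a = 0 := by omega
    simp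
  · exact ⟨mul_nonneg_of_nonpos_of_nonpos ha hb, by
      rw [abs_of_nonpos ha, abs_of_nonpos hb]; omega⟩

theorem sqle_of_signParts_projVec_le {n l : ℕ} {u v : Fin n → ℤ}
    (h : signParts (projVec n l u) ≤ signParts (projVec n l v)) : sqle n l u v := by
  intro i hi
  have h' := Prod.le_def.1 (h i)
  simp only [signParts, projVec, hi, if_true] at h'
  exact mul_nonneg_and_abs_le_of_toNat_le h'.1 h'.2

/-- The `⊑_l`-minimal elements of `Q_b^{(k)}` fall into finitely many equivalence classes
under equality of the first `l` components. -/
theorem stmt5 (d n k l : ℕ) (hn : 0 < n) (hk : k ≤ n) (hl : l ≤ n)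
    (A : Matrix (Fin d) (Fin n) ℤ) (b : Fin d → ℤ) :
    Set.Finite (projVec n l ''
      {v | v ∈ Qfib A k b ∧
        ¬ ∃ w ∈ Qfib A k b, projVec n l w ≠ projVec n l v ∧ sqle n l w v}) := by
  refine Set.Finite.of_finite_image (f := signParts) ?_ signParts_injective.injOn
  refine WellQuasiOrderedLE.finite_of_isAntichain ?_
  rintro _ ⟨_, ⟨w, ⟨hw, -⟩, rfl⟩, rfl⟩ _ ⟨_, ⟨v, ⟨-, hv⟩, rfl⟩, rfl⟩ hne hle
  exact hv ⟨w, hw, fun h => hne (congrArg signParts h), sqle_of_signParts_projVec_le hle⟩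
end

section
/- Let 0 ≤ k ≤ l ≤ n and let b_1, b_2 ∈ ℤ^d with Q_{b_1}^{(k)} ≠ ∅ and Q_{b_2}^{(k)} ≠ ∅. Then Q_{b_1+b_2}^{(k)} = Q_{b_1}^{(k)} ⊕^{(l)} Q_{b_2}^{(k)} if and only if for every v ∈ Q_{b_1+b_2}^{(k)} that is minimal w.r.t. ⊑_l there exists w ∈ Q_{b_1}^{(k)} with w ⊑_l v. -/
open Matrix Pointwise

theorem mul_nonneg_and_abs_le_abs_iff {a b : ℤ} :
    (0 ≤ a * b ∧ |a| ≤ |b|) ↔ (0 ≤ a ∧ a ≤ b) ∨ (b ≤ a ∧ a ≤ 0) := by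
  constructor
  · rintro ⟨h, h'⟩
    rcases mul_nonneg_iff.1 h with ⟨ha, hb⟩ | ⟨ha, hb⟩
    · rw [abs_of_nonneg ha, abs_of_nonneg hb] at h'
      exact Or.inl ⟨ha, h'⟩
    · rw [abs_of_nonpos ha, abs_of_nonpos hb] at h'
      exact Or.inr ⟨by omega, ha⟩
  · rintro (⟨ha, hb⟩ | ⟨hb, ha⟩)
    · exact ⟨mul_nonneg ha (ha.trans hb), abs_le_abs_of_nonneg ha hb⟩
    · exact ⟨mul_nonneg_of_nonpos_of_nonpos ha (hb.trans ha), abs_le_abs_of_nonpos ha hb⟩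

theorem sqle_iff {n l : ℕ} {u v : Fin n → ℤ} :
    sqle n l u v ↔
      ∀ i : Fin n, (i : ℕ) < l → (0 ≤ u i ∧ u i ≤ v i) ∨ (v i ≤ u i ∧ u i ≤ 0) :=
  forall₂_congr fun _ _ => mul_nonneg_and_abs_le_abs_iff

theorem sqle_refl {n l : ℕ} (u : Fin n → ℤ) : sqle n l u u :=
  fun i _ => ⟨mul_self_nonneg (u i), le_rfl⟩

theorem sqle.trans {n l : ℕ} {u v w : Fin n → ℤ} (huv : sqle n l u v) (hvw : sqle n l v w) :
    sqle n l u w := by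
  rw [sqle_iff] at *
  intro i hi
  have := huv i hi
  have := hvw i hi
  omega

theorem sqle.sub {n l : ℕ} {u v : Fin n → ℤ} (h : sqle n l u v) : sqle n l (v - u) v := by
  rw [sqle_iff] at *
  intro i hi
  have := h i hi
  simp only [Pi.sub_apply]
  omega

theorem sqle.sum_natAbs_lt {n l : ℕ} {u v : Fin n → ℤ} (h : sqle n l u v)
    (hne : projVec n l u ≠ projVec n l v) :
    ∑ i, (projVec n l u i).natAbs < ∑ i, (projVec n l v i).natAbs := by
  rw [sqle_iff] at h
  obtain ⟨j, hj⟩ := Function.ne_iff.1 hne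
  apply Finset.sum_lt_sum
  · intro i _
    have := h i
    simp only [projVec]
    split_ifs <;> omega
  · refine ⟨j, Finset.mem_univ j, ?_⟩
    have := h j
    simp only [projVec] at hj ⊢
    split_ifs at hj ⊢ <;> omega

/-- Every element of a set of integer vectors dominates a `⊑_l`-minimal one. -/
theorem exists_minimal_sqle {n : ℕ} (l : ℕ) (U : Set (Fin n → ℤ)) {u : Fin n → ℤ} (hu : u ∈ U) :
    ∃ v ∈ U, (¬ ∃ w ∈ U, projVec n l w ≠ projVec n l v ∧ sqle n l w v) ∧ sqle n l v u := by
  induction hm : ∑ i, (projVec n l u i).natAbs using Nat.strong_induction_on generalizing u with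
  | _ m ih =>
    by_cases h : ∃ w ∈ U, projVec n l w ≠ projVec n l u ∧ sqle n l w u
    · obtain ⟨w, hw, hne, hwu⟩ := h
      obtain ⟨v, hv, hmin, hvw⟩ := ih _ (hm ▸ hwu.sum_natAbs_lt hne) hw rfl
      exact ⟨v, hv, hmin, hvw.trans hwu⟩
    · exact ⟨u, hu, h, sqle_refl u⟩

theorem sub_mem_Qfib {d n k l : ℕ} (hkl : k ≤ l) {A : Matrix (Fin d) (Fin n) ℤ}
    {b₁ b₂ : Fin d → ℤ} {u w : Fin n → ℤ} (hu : u ∈ Qfib A k (b₁ + b₂)) (hw : w ∈ Qfib A k b₁)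
    (h : sqle n l w u) : u - w ∈ Qfib A k b₂ := by
  refine ⟨by rw [Matrix.mulVec_sub, hu.1, hw.1, add_sub_cancel_left], fun i hi => ?_⟩
  have := sqle_iff.1 h i (hi.trans_le hkl)
  have := hu.2 i hi
  have := hw.2 i hi
  simp only [Pi.sub_apply]
  omega

/-- `Q_{b₁+b₂}^{(k)} = Q_{b₁}^{(k)} ⊕^{(l)} Q_{b₂}^{(k)}` iff every `⊑_l`-minimal element
`v` of `Q_{b₁+b₂}^{(k)}` admits `w ∈ Q_{b₁}^{(k)}` with `w ⊑_l v`. -/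
theorem stmt6 (d n k l : ℕ) (hn : 0 < n) (hkl : k ≤ l) (hln : l ≤ n)
    (A : Matrix (Fin d) (Fin n) ℤ) (b₁ b₂ : Fin d → ℤ)
    (h₁ : (Qfib A k b₁).Nonempty) (h₂ : (Qfib A k b₂).Nonempty) :
    oplus l (Qfib A k (b₁ + b₂)) (Qfib A k b₁) (Qfib A k b₂) ↔
      ∀ v ∈ Qfib A k (b₁ + b₂),
        (¬ ∃ w ∈ Qfib A k (b₁ + b₂), projVec n l w ≠ projVec n l v ∧ sqle n l w v) →
        ∃ w ∈ Qfib A k b₁, sqle n l w v := by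
  constructor
  · intro h v hv _
    obtain ⟨w, hw, _, _, hwv, _⟩ := h v hv
    exact ⟨w, hw, hwv⟩
  · intro h u hu
    obtain ⟨v, hv, hmin, hvu⟩ := exists_minimal_sqle l _ hu
    obtain ⟨w, hw, hwv⟩ := h v hv hmin
    have hwu := hwv.trans hvu
    exact ⟨w, hw, u - w, sub_mem_Qfib hkl hu hw hwu, hwu, hwu.sub, (add_sub_cancel w u).symm⟩
end

section
/- Let M ⊆ ℤ^d be a submonoid, let 0 ≤ k ≤ l ≤ n, and let b, b̄ ∈ M with b̄ ⪯_l b, i.e., b − b̄ ∈ S̄^{(l)}. Then π_l(Q_{b̄}^{(k)}) = π_l(Q_b^{(k)}) and Q_b^{(k)} = Q_{b̄}^{(k)} ⊕^{(l)} Q_{b−b̄}^{(k)}. -/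
open Matrix Pointwise

/-- Translating a point of a partially extended fiber by a vector vanishing on the first `k`
components moves it to the fiber of the shifted right-hand side. -/
theorem Qfib_add_mem {d n k : ℕ} {A : Matrix (Fin d) (Fin n) ℤ} {b : Fin d → ℤ}
    {z t : Fin n → ℤ} (hz : z ∈ Qfib A k b) (ht : ∀ i : Fin n, (i : ℕ) < k → t i = 0) :
    z + t ∈ Qfib A k (b + A.mulVec t) := by
  refine ⟨by rw [Matrix.mulVec_add, hz.1], fun i hi => ?_⟩
  rw [Pi.add_apply, ht i hi, add_zero]
  exact hz.2 i hi

/-- Adding a vector that vanishes on the first `l` components does not change the projection. -/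
theorem projVec_add {n l : ℕ} {z t : Fin n → ℤ} (ht : ∀ i : Fin n, (i : ℕ) < l → t i = 0) :
    projVec n l (z + t) = projVec n l z := by
  ext i
  by_cases hi : (i : ℕ) < l
  · simp [projVec, ht i hi]
  · simp [projVec, hi]

/-- Projected fibers grow under translation by vectors vanishing on the first `l` components. -/
theorem projSet_Qfib_subset {d n k l : ℕ} (hkl : k ≤ l) {A : Matrix (Fin d) (Fin n) ℤ}
    {b : Fin d → ℤ} {t : Fin n → ℤ} (ht : ∀ i : Fin n, (i : ℕ) < l → t i = 0) :
    projSet l (Qfib A k b) ⊆ projSet l (Qfib A k (b + A.mulVec t)) := by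
  rintro _ ⟨z, hz, rfl⟩
  exact ⟨z + t, Qfib_add_mem hz fun i hi => ht i (hi.trans_le hkl), projVec_add ht⟩

/-- If `b̄ ⪯_l b` (i.e. `b − b̄ ∈ S̄^{(l)}`) for `b, b̄` in a submonoid `M`, then
`π_l(Q_{b̄}^{(k)}) = π_l(Q_b^{(k)})` and `Q_b^{(k)} = Q_{b̄}^{(k)} ⊕^{(l)} Q_{b−b̄}^{(k)}`. -/
theorem stmt10 (d n k l : ℕ) (hn : 0 < n) (hkl : k ≤ l) (hln : l ≤ n)
    (A : Matrix (Fin d) (Fin n) ℤ) (M : AddSubmonoid (Fin d → ℤ))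
    (b bbar : Fin d → ℤ) (hb : b ∈ M) (hbbar : bbar ∈ M)
    (hpre : b - bbar ∈ SbarSet A l (M : Set (Fin d → ℤ))) :
    projSet l (Qfib A k bbar) = projSet l (Qfib A k b) ∧
      oplus l (Qfib A k b) (Qfib A k bbar) (Qfib A k (b - bbar)) := by
  obtain ⟨-, t, ht, hbt⟩ := hpre
  have hneg : ∀ i : Fin n, (i : ℕ) < l → (-t) i = 0 := fun i hi => by simp [ht i hi]
  have hb_eq : bbar + A.mulVec t = b := by rw [← hbt]; abel
  have hbbar_eq : b + A.mulVec (-t) = bbar := by rw [Matrix.mulVec_neg, ← hbt]; abel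
  refine ⟨Set.Subset.antisymm ?_ ?_, fun u hu => ?_⟩
  · simpa only [hb_eq] using projSet_Qfib_subset (A := A) (b := bbar) hkl ht
  · simpa only [hbbar_eq] using projSet_Qfib_subset (A := A) (b := b) hkl hneg
  · refine ⟨u + -t, ?_, t, ⟨hbt.symm, fun i hi => (ht i (hi.trans_le hkl)).ge⟩,
      fun i hi => ?_, fun i hi => ?_, by abel⟩
    · simpa only [hbbar_eq] using Qfib_add_mem hu fun i hi => hneg i (hi.trans_le hkl)
    · simp [ht i hi, mul_self_nonneg]
    · simp [ht i hi]
end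

section
/- For every b ∈ M with P_b ≠ ∅ there exist finitely many b_1,…,b_r ∈ M such that each fiber P_{b_i} is atomic w.r.t. ⊕ and M and P_b = ⊕_{i=1}^r P_{b_i}; i.e., every nonempty fiber with right-hand side in M is a finite sign-compatible Minkowski sum of atomic fibers. -/
open Matrix Pointwise

theorem sqle_trans_of_nonneg {n l : ℕ} {u v w : Fin n → ℤ}
    (hu : ∀ i : Fin n, (i : ℕ) < l → 0 ≤ u i) (hw : ∀ i : Fin n, (i : ℕ) < l → 0 ≤ w i)
    (huv : sqle n l u v) (hvw : sqle n l v w) : sqle n l u w :=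
  fun i hi => ⟨mul_nonneg (hu i hi) (hw i hi), (huv i hi).2.trans (hvw i hi).2⟩

theorem oplusFam_singleton {n l : ℕ} (U : Set (Fin n → ℤ)) :
    oplusFam l U (fun _ : Fin 1 => U) :=
  fun u hu => ⟨fun _ => u, fun _ => hu, fun _ => sqle_refl u, by simp⟩

/-- Decompositions of the two summands of a fiber concatenate to one of the fiber. -/
theorem oplus.oplusFam_append {d n k r₁ r₂ : ℕ} {A : Matrix (Fin d) (Fin n) ℤ}
    {b b₁ b₂ : Fin d → ℤ} {c₁ : Fin r₁ → Fin d → ℤ} {c₂ : Fin r₂ → Fin d → ℤ}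
    (h : oplus k (Qfib A k b) (Qfib A k b₁) (Qfib A k b₂))
    (h₁ : oplusFam k (Qfib A k b₁) fun i => Qfib A k (c₁ i))
    (h₂ : oplusFam k (Qfib A k b₂) fun i => Qfib A k (c₂ i)) :
    oplusFam k (Qfib A k b) fun i => Qfib A k (Fin.append c₁ c₂ i) := by
  intro u hu
  obtain ⟨v, hv, w, hw, hvu, hwu, rfl⟩ := h u hu
  obtain ⟨x, hx, hxv, rfl⟩ := h₁ v hv
  obtain ⟨y, hy, hyw, rfl⟩ := h₂ w hw
  refine ⟨Fin.append x y, fun j => ?_, fun j => ?_, by simp [Fin.sum_univ_add]⟩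
  · refine Fin.addCases (fun i => ?_) (fun i => ?_) j
    · simpa using hx i
    · simpa using hy i
  · refine Fin.addCases (fun i => ?_) (fun i => ?_) j
    · simpa using sqle_trans_of_nonneg (hx i).2 hu.2 (hxv i) hvu
    · simpa using sqle_trans_of_nonneg (hy i).2 hu.2 (hyw i) hwu

/-- A member of a fiber distinct from the zero fiber has positive coordinate sum. -/
theorem sum_pos_of_mem_Qfib {d n : ℕ} {A : Matrix (Fin d) (Fin n) ℤ} {b : Fin d → ℤ}
    {v : Fin n → ℤ} (hv : v ∈ Qfib A n b) (hb : Qfib A n b ≠ Qfib A n 0) :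
    0 < ∑ i, v i := by
  have hnn : ∀ i ∈ Finset.univ, 0 ≤ v i := fun i _ => hv.2 i i.2
  refine (Finset.sum_nonneg hnn).lt_of_ne fun h => hb ?_
  have hv0 : v = 0 :=
    funext fun i => (Finset.sum_eq_zero_iff_of_nonneg hnn).1 h.symm i (Finset.mem_univ i)
  have hb0 : b = 0 := by rw [← hv.1, hv0, Matrix.mulVec_zero]
  rw [hb0]

theorem exists_atomic_decomposition {d n : ℕ} (A : Matrix (Fin d) (Fin n) ℤ)
    (M : Set (Fin d → ℤ)) {b : Fin d → ℤ} (hb : b ∈ M) {u : Fin n → ℤ} (hu : u ∈ Qfib A n b) :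
    ∃ (r : ℕ) (c : Fin r → Fin d → ℤ),
      (∀ i, c i ∈ M ∧ AtomicFiberQ A n M (c i)) ∧
      oplusFam n (Qfib A n b) (fun i => Qfib A n (c i)) := by
  induction hN : (∑ i, u i).toNat using Nat.strong_induction_on generalizing b u with
  | _ N ih =>
    by_cases hat : AtomicFiberQ A n M b
    · exact ⟨1, fun _ => b, fun _ => ⟨hb, hat⟩, oplusFam_singleton _⟩
    obtain ⟨b₁, hb₁, b₂, hb₂, hsum, hne₁, hne₂⟩ := not_not.1 hat
    obtain ⟨v, hv, w, hw, -, -, rfl⟩ := hsum u hu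
    have hvpos := sum_pos_of_mem_Qfib hv hne₁
    have hwpos := sum_pos_of_mem_Qfib hw hne₂
    simp only [Pi.add_apply, Finset.sum_add_distrib] at hN
    obtain ⟨r₁, c₁, hc₁, h₁⟩ := ih _ (by omega) hb₁ hv rfl
    obtain ⟨r₂, c₂, hc₂, h₂⟩ := ih _ (by omega) hb₂ hw rfl
    refine ⟨r₁ + r₂, Fin.append c₁ c₂, fun j => ?_, hsum.oplusFam_append h₁ h₂⟩
    refine Fin.addCases (fun i => ?_) (fun i => ?_) j
    · simpa using hc₁ i
    · simpa using hc₂ i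

/-- Every nonempty fiber `P_b = Q_b^{(n)}` with `b ∈ M` is a finite sign-compatible
Minkowski sum of fibers atomic w.r.t. `⊕` and `M`. -/
theorem stmt13 (d n t : ℕ) (hn : 0 < n) (A : Matrix (Fin d) (Fin n) ℤ)
    (m : Fin t → Fin d → ℤ) (b : Fin d → ℤ) (hb : b ∈ monoidGen m)
    (hne : (Qfib A n b).Nonempty) :
    ∃ (r : ℕ) (bfam : Fin r → Fin d → ℤ),
      (∀ i, bfam i ∈ monoidGen m ∧ AtomicFiberQ A n (monoidGen m) (bfam i)) ∧
      oplusFam n (Qfib A n b) (fun i => Qfib A n (bfam i)) := by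
  obtain ⟨u, hu⟩ := hne
  exact exists_atomic_decomposition A (monoidGen m) hb hu
end

section
/- Fix 1 ≤ k ≤ n and let b ∈ M with Q_b^{(k)} ≠ ∅. If Q_b^{(k)} is atomic w.r.t. ⊕^{(k)} and M, then Q_b^{(k−1)} is atomic w.r.t. ⊕^{(k)} and M. -/
open Matrix Pointwise

theorem sqle.nonneg {n l : ℕ} {v u : Fin n → ℤ} (h : sqle n l v u) {i : Fin n}
    (hi : (i : ℕ) < l) (hu : 0 ≤ u i) : 0 ≤ v i := by
  obtain ⟨h1, h2⟩ := h i hi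
  rcases hu.eq_or_lt with h0 | h0
  · rw [← h0, abs_zero] at h2
    exact (abs_nonpos_iff.mp h2).ge
  · exact nonneg_of_mul_nonneg_left h1 h0

theorem Qfib_anti {d n : ℕ} (A : Matrix (Fin d) (Fin n) ℤ) {j k : ℕ} (hjk : j ≤ k)
    (b : Fin d → ℤ) : Qfib A k b ⊆ Qfib A j b :=
  fun _ hz => ⟨hz.1, fun i hi => hz.2 i (hi.trans_le hjk)⟩

/-- A decomposition with respect to `⊕^{(k)}` of a fiber of order `j ≤ k` restricts to one of the
fiber of order `k`. -/
theorem oplus_Qfib_restrict {d n j k : ℕ} (hjk : j ≤ k) (A : Matrix (Fin d) (Fin n) ℤ)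
    {b b₁ b₂ : Fin d → ℤ} (h : oplus k (Qfib A j b) (Qfib A j b₁) (Qfib A j b₂)) :
    oplus k (Qfib A k b) (Qfib A k b₁) (Qfib A k b₂) := by
  intro u hu
  obtain ⟨v, hv, w, hw, hvu, hwu, huvw⟩ := h u (Qfib_anti A hjk b hu)
  exact ⟨v, ⟨hv.1, fun i hi => hvu.nonneg hi (hu.2 i hi)⟩,
    w, ⟨hw.1, fun i hi => hwu.nonneg hi (hu.2 i hi)⟩, hvu, hwu, huvw⟩

/-- If `A s = c - b` for some `s` vanishing on the first `l` components, then the projection of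
the fiber of `b` is contained in that of the fiber of `c`. -/
theorem projSet_Qfib_subset_of_mulVec {d n j l : ℕ} (hjl : j ≤ l)
    (A : Matrix (Fin d) (Fin n) ℤ) {b c : Fin d → ℤ} {s : Fin n → ℤ}
    (hs : A.mulVec s = c - b) (hs0 : ∀ i : Fin n, (i : ℕ) < l → s i = 0) :
    projSet l (Qfib A j b) ⊆ projSet l (Qfib A j c) := by
  rintro _ ⟨z, ⟨hz, hz0⟩, rfl⟩
  refine ⟨z + s, ⟨by rw [Matrix.mulVec_add, hz, hs, add_sub_cancel], fun i hi => ?_⟩, ?_⟩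
  · simpa [hs0 i (hi.trans_le hjl)] using hz0 i hi
  · funext i
    by_cases hi : (i : ℕ) < l <;> simp [projVec, hi, hs0]

/-- Equality of the projections of the fibers of `b` and `0` passes to fibers of lower order. -/
theorem projSet_Qfib_eq_zero_of_le {d n j k : ℕ} (hjk : j ≤ k)
    (A : Matrix (Fin d) (Fin n) ℤ) {b : Fin d → ℤ}
    (h : projSet k (Qfib A k b) = projSet k (Qfib A k 0)) :
    projSet k (Qfib A j b) = projSet k (Qfib A j 0) := by
  have h0 : projVec n k 0 ∈ projSet k (Qfib A k b) :=
    h ▸ ⟨0, ⟨Matrix.mulVec_zero A, fun _ _ => le_rfl⟩, rfl⟩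
  obtain ⟨s, ⟨hs, -⟩, hsp⟩ := h0
  have hs0 : ∀ i : Fin n, (i : ℕ) < k → s i = 0 := fun i hi => by
    simpa [projVec, hi] using congrFun hsp i
  apply Set.Subset.antisymm
  · exact projSet_Qfib_subset_of_mulVec hjk A (s := -s) (by rw [Matrix.mulVec_neg, hs, zero_sub])
      fun i hi => by simp [hs0 i hi]
  · exact projSet_Qfib_subset_of_mulVec hjk A (by rw [hs, sub_zero]) hs0

/-- If `Q_b^{(k)}` (nonempty, `b ∈ M`) is atomic w.r.t. `⊕^{(k)}` and `M`, then
`Q_b^{(k−1)}` is atomic w.r.t. `⊕^{(k)}` and `M`. -/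
theorem stmt14 (d n k : ℕ) (hk1 : 1 ≤ k) (hkn : k ≤ n)
    (A : Matrix (Fin d) (Fin n) ℤ) (M : AddSubmonoid (Fin d → ℤ))
    (b : Fin d → ℤ) (hb : b ∈ M) (hne : (Qfib A k b).Nonempty)
    (hatom : AtomicFiber A k k (M : Set (Fin d → ℤ)) b) :
    AtomicFiber A (k - 1) k (M : Set (Fin d → ℤ)) b := by
  rintro ⟨b₁, hb₁, b₂, hb₂, hsum, hne₁, hne₂⟩
  exact hatom ⟨b₁, hb₁, b₂, hb₂, oplus_Qfib_restrict (Nat.sub_le k 1) A hsum,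
    mt (projSet_Qfib_eq_zero_of_le (Nat.sub_le k 1) A) hne₁,
    mt (projSet_Qfib_eq_zero_of_le (Nat.sub_le k 1) A) hne₂⟩
end

section
/- Let M ⊆ ℤ^d be a submonoid generated by finitely many elements m_1,…,m_t ∈ ℤ^d and let A ∈ ℤ^{d×n} have columns A_1,…,A_n. Then for every 0 ≤ l ≤ n the monoid S̄^{(l)} := {λ_{l+1}A_{l+1} + … + λ_nA_n : λ_{l+1},…,λ_n ∈ ℤ} ∩ M is a finitely generated submonoid of ℤ^d. -/
open Matrix Pointwise

/-- The intersection of a subgroup with a finitely generated submonoid of a commutative group is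
finitely generated, presented as the image of a submonoid of `ℕ^ι`. -/
theorem fg_map_comap_addSubgroup {ι G : Type*} [Finite ι] [AddCommGroup G]
    (φ : (ι → ℕ) →+ G) (H : AddSubgroup G) :
    ((H.toAddSubmonoid.comap φ).map φ).FG := by
  refine AddSubmonoid.FG.map (AddSubmonoid.fg_of_subtractive fun x hx y hxy => ?_) φ
  have hx' : φ x ∈ H := hx
  have hxy' : φ (x + y) ∈ H := hxy
  rw [map_add] at hxy'
  exact (H.add_mem_cancel_left hx').mp hxy'

/-- The homomorphism `ℕ^ι → G` sending `α` to `∑ i, α i • m i`. -/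
def natCombination {ι G : Type*} [Fintype ι] [AddCommGroup G] (m : ι → G) : (ι → ℕ) →+ G where
  toFun α := ∑ i, (α i : ℤ) • m i
  map_zero' := by simp
  map_add' α β := by simp [add_smul, Finset.sum_add_distrib]

/-- The group of integer combinations of the columns of `A` with index at least `l`. -/
def trailingColumnSpan {d n : ℕ} (A : Matrix (Fin d) (Fin n) ℤ) (l : ℕ) :
    AddSubgroup (Fin d → ℤ) where
  carrier := {s | ∃ lam : Fin n → ℤ, (∀ i : Fin n, (i : ℕ) < l → lam i = 0) ∧ s = A.mulVec lam}
  zero_mem' := ⟨0, by simp⟩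
  add_mem' := by
    rintro _ _ ⟨u, hu, rfl⟩ ⟨v, hv, rfl⟩
    exact ⟨u + v, fun i hi => by simp [hu i hi, hv i hi], (A.mulVec_add u v).symm⟩
  neg_mem' := by
    rintro _ ⟨u, hu, rfl⟩
    exact ⟨-u, fun i hi => by simp [hu i hi], (A.mulVec_neg u).symm⟩

/-- `S̄^{(l)}`, the intersection of the subgroup generated by the last `n − l` columns of
`A` with a finitely generated monoid `M`, is a finitely generated submonoid of `ℤ^d`. -/
theorem stmt15 (d n t l : ℕ) (hn : 0 < n) (hl : l ≤ n)
    (A : Matrix (Fin d) (Fin n) ℤ) (m : Fin t → Fin d → ℤ) :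
    ∃ S : AddSubmonoid (Fin d → ℤ),
      (S : Set (Fin d → ℤ)) = SbarSet A l (monoidGen m) ∧ S.FG := by
  refine ⟨((trailingColumnSpan A l).toAddSubmonoid.comap (natCombination m)).map
    (natCombination m), ?_, fg_map_comap_addSubgroup _ _⟩
  ext s
  constructor
  · rintro ⟨α, hα, rfl⟩
    exact ⟨⟨α, rfl⟩, hα⟩
  · rintro ⟨⟨α, rfl⟩, h⟩
    exact ⟨α, h, rfl⟩
end

section
/- Fix 1 ≤ k ≤ n and a subgroup Λ ⊆ ℤ^d, taking M = Λ. Let λ*_k,…,λ*_n ∈ ℤ with λ*_k ≥ 1 and s := λ*_kA_k + … + λ*_nA_n ∈ Λ, and suppose λ*_k is minimal in the sense that every (μ_k,…,μ_n) ∈ ℤ^{n−k+1} with μ_kA_k + … + μ_nA_n ∈ Λ and μ_k ≠ 0 satisfies |μ_k| ≥ λ*_k. Let F ⊆ Λ be such that for every b ∈ Λ with Q_b^{(k−1)} ≠ ∅ and Q_b^{(k−1)} atomic w.r.t. ⊕^{(k−1)} and Λ there exists b̄ ∈ F with b̄ ⪯_{k−1} b. Then for every such b there exist b̄ ∈ F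 and m ∈ ℤ with b̄ + m·s ⪯_k b, i.e., b − b̄ − m·s ∈ S̄^{(k)}. -/
open Matrix Pointwise

/-- With `s = λ*_kA_k + … + λ*_nA_n ∈ Λ`, `λ*_k ≥ 1` minimal, and `F` covering the atomic
fibers of order `k−1` w.r.t. `⪯_{k−1}`, every atomic `Q_b^{(k−1)}` admits `b̄ ∈ F` and
`m ∈ ℤ` with `b̄ + m·s ⪯_k b`. -/
theorem stmt17 (d n k : ℕ) (hk1 : 1 ≤ k) (hkn : k ≤ n)
    (A : Matrix (Fin d) (Fin n) ℤ) (Λ : AddSubgroup (Fin d → ℤ))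
    (lamstar : Fin n → ℤ)
    (hsupp : ∀ i : Fin n, (i : ℕ) < k - 1 → lamstar i = 0)
    (hpos : 1 ≤ lamstar ⟨k - 1, by omega⟩)
    (hsΛ : A.mulVec lamstar ∈ Λ)
    (hmin : ∀ mu : Fin n → ℤ, (∀ i : Fin n, (i : ℕ) < k - 1 → mu i = 0) →
      A.mulVec mu ∈ Λ → mu ⟨k - 1, by omega⟩ ≠ 0 →
      lamstar ⟨k - 1, by omega⟩ ≤ |mu ⟨k - 1, by omega⟩|)
    (F : Set (Fin d → ℤ)) (hFsub : F ⊆ (Λ : Set (Fin d → ℤ)))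
    (hcover : ∀ b ∈ Λ, (Qfib A (k - 1) b).Nonempty →
      AtomicFiber A (k - 1) (k - 1) (Λ : Set (Fin d → ℤ)) b →
      ∃ bbar ∈ F, b - bbar ∈ SbarSet A (k - 1) (Λ : Set (Fin d → ℤ))) :
    ∀ b ∈ Λ, (Qfib A (k - 1) b).Nonempty →
      AtomicFiber A (k - 1) (k - 1) (Λ : Set (Fin d → ℤ)) b →
      ∃ bbar ∈ F, ∃ mz : ℤ,
        b - bbar - mz • A.mulVec lamstar ∈ SbarSet A k (Λ : Set (Fin d → ℤ)) := by
  intro b hb hne hat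
  obtain ⟨bbar, hbbar, hΛ, lam, hlam, heq⟩ := hcover b hb hne hat
  refine ⟨bbar, hbbar, lam ⟨k - 1, by omega⟩ / lamstar ⟨k - 1, by omega⟩, ?_⟩
  set p : Fin n := ⟨k - 1, by omega⟩
  set q : ℤ := lam p / lamstar p
  have hmem : b - bbar - q • A.mulVec lamstar ∈ Λ :=
    Λ.sub_mem hΛ (Λ.zsmul_mem hsΛ q)
  have hmul : b - bbar - q • A.mulVec lamstar = A.mulVec (lam - q • lamstar) := by
    rw [heq, mulVec_sub, mulVec_smul]
  have hlow : ∀ i : Fin n, (i : ℕ) < k - 1 → (lam - q • lamstar) i = 0 := fun i hi => by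
    simp [hlam i hi, hsupp i hi]
  have hmod : (lam - q • lamstar) p = lam p % lamstar p := by
    simp [q, Int.emod_def, mul_comm]
  have hzero : (lam - q • lamstar) p = 0 := by
    by_contra h
    have hle := hmin _ hlow (hmul ▸ hmem) h
    rw [hmod, abs_of_nonneg (Int.emod_nonneg _ (by omega))] at hle
    exact hle.not_gt (Int.emod_lt_of_pos _ (by omega))
  refine ⟨hmem, lam - q • lamstar, fun i hi => ?_, hmul⟩
  rcases Nat.lt_or_ge i (k - 1) with h | h
  · exact hlow i h
  · rwa [show i = p from Fin.ext (show (i : ℕ) = k - 1 by omega)]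
end
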